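/- Let μ, ν ∈ ℝ with μ + ν > −1 and μ − ν an even nonnegative integer, let n ≥ 0, and let φ_n and φ_{n+1} be the monic orthogonal polynomials of degrees n and n+1 for the weight w_{μ,ν}; assume φ_n(0) ≠ 0. Then the rational expression P(x) := (−1)^{n+1} ( φ_{n+1}(−x²) − (φ_{n+1}(0)/φ_n(0)) φ_n(−x²) ) / x is a monic polynomial of degree 2n+1 which is orthogonal with respect to x^μ J_ν(x) on (0,∞), and every monic polynomial of degree 2n+1 that is orthogonal with respect to x^μ J_ν(x) on (0,∞) equals P. -/

import Mathlib

open MeasureTheory Filter Set Polynomial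
open scoped Classical

noncomputable section

/-- The Abel limit of `∫₀^∞ g(x) dx` is `L`: for every `s > 0` the integral
`∫₀^∞ e^{-s x} g(x) dx` converges and these integrals tend to `L` as `s → 0⁺`. -/
def HasAbelLimit (g : ℝ → ℂ) (L : ℂ) : Prop :=
  (∀ s : ℝ, 0 < s →
    IntegrableOn (fun x : ℝ => Complex.exp (-(s : ℂ) * (x : ℂ)) * g x) (Set.Ioi 0)) ∧
  Tendsto (fun s : ℝ => ∫ x in Set.Ioi (0:ℝ), Complex.exp (-(s : ℂ) * (x : ℂ)) * g x)
    (nhdsWithin 0 (Set.Ioi 0)) (nhds L)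

/-- Bessel function of the first kind of order `ν`, for `x > 0`, with the convention
`1/Γ(z) = 0` at nonpositive integers `z` (automatic since `Real.Gamma` vanishes there). -/
def besselJ (ν x : ℝ) : ℝ :=
  ∑' k : ℕ, ((-1 : ℝ) ^ k / ((k.factorial : ℝ) * Real.Gamma (ν + k + 1))) *
    (x / 2) ^ (ν + 2 * (k : ℝ))

/-- Modified Bessel function of the second kind of order `ν`, for `x > 0`. -/
def besselK (ν x : ℝ) : ℝ :=
  ∫ t in Set.Ioi (0:ℝ), Real.exp (-x * Real.cosh t) * Real.cosh (ν * t)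

/-- The weight function `w_{μ,ν}` on `(0,∞)`. -/
def weightW (μ ν : ℝ) (x : ℝ) : ℝ :=
  if ∃ m : ℤ, μ - ν = 2 * m then (1/2) * x ^ ((μ - 1)/2) * besselK ν (Real.sqrt x)
  else (1/2) * x ^ (μ/2) * besselK ν (Real.sqrt x)

/-- `0 < x_1 < ⋯ < x_n` together with positive weights `w_1, …, w_n` form an `n`-point
Gaussian quadrature rule for `w_{μ,ν}`. -/
def IsGaussRule (μ ν : ℝ) (n : ℕ) (xs ws : Fin n → ℝ) : Prop :=
  StrictMono xs ∧ (∀ j, 0 < xs j) ∧ (∀ j, 0 < ws j) ∧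
  ∀ p : Polynomial ℝ, p.natDegree ≤ 2 * n - 1 →
    ∑ j, ws j * p.eval (xs j) = ∫ x in Set.Ioi (0:ℝ), weightW μ ν x * p.eval x

/-- `κ = μ` if `μ - ν` is even and `κ = μ + 1` if `μ - ν` is odd. -/
def kappaQ (μ ν : ℕ) : ℝ := if Even (μ - ν) then (μ : ℝ) else (μ : ℝ) + 1

/-- The boundary weights `ŵ_k⁰` of the generalized Gauss–Radau rule. -/
def wHat0 (μ ν : ℕ) {n : ℕ} (xs ws : Fin n → ℝ) (k : ℕ) : ℝ :=
  (1 / (k.factorial : ℝ)) *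
    (2 ^ k * Real.Gamma (((ν : ℝ) + k + 1)/2) / Real.Gamma (((ν : ℝ) - k + 1)/2)
      - (2 / Real.pi) * Real.cos (((k : ℝ) - ν) * Real.pi / 2) *
          ∑ j, ws j * (xs j) ^ (((k : ℝ) - kappaQ μ ν)/2))

/-- The generalized Gauss–Radau rule `(Q_{2n,μ} f)(ω)`. -/
def QRule (μ ν : ℕ) {n : ℕ} (xs ws : Fin n → ℝ) (f : ℂ → ℂ) (ω : ℝ) : ℂ :=
  (1 / (ω : ℂ)) *
    ((∑ k ∈ Finset.range μ, (wHat0 μ ν xs ws k : ℂ) / (ω : ℂ) ^ k * iteratedDeriv k f 0)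
      + ∑ j, ((ws j * (xs j) ^ (-(kappaQ μ ν)/2) / Real.pi : ℝ) : ℂ) *
          (Complex.exp (-(ν : ℂ) * (Real.pi : ℂ) * Complex.I / 2) *
              f (Complex.I * (Real.sqrt (xs j) : ℂ) / (ω : ℂ))
            + Complex.exp ((ν : ℂ) * (Real.pi : ℂ) * Complex.I / 2) *
              f (-Complex.I * (Real.sqrt (xs j) : ℂ) / (ω : ℂ))))

/-- `P` is a monic polynomial of degree `m` orthogonal with respect to `x^μ J_ν(x)`
on `(0,∞)`, all integrals taken in the Abel-limit sense. -/
def MonicOrthoBessel (μ ν : ℝ) (m : ℕ) (P : Polynomial ℂ) : Prop :=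
  P.Monic ∧ P.natDegree = m ∧
  ∀ k < m, HasAbelLimit
    (fun x : ℝ => P.eval (x : ℂ) * ((x ^ ((k : ℝ) + μ) : ℝ) : ℂ) * (besselJ ν x : ℂ)) 0

/-- `φ` is the monic real polynomial of degree `m` orthogonal to all lower powers
with respect to the weight `w_{μ,ν}` on `(0,∞)`. -/
def IsMonicOrthoW (μ ν : ℝ) (m : ℕ) (φ : Polynomial ℝ) : Prop :=
  φ.Monic ∧ φ.natDegree = m ∧
  ∀ k < m, ∫ x in Set.Ioi (0:ℝ), weightW μ ν x * φ.eval x * x ^ k = 0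


/-- `1/Γ(ν+k+1)` satisfies the downward recurrence of the reciprocal Gamma function,
including at the poles. -/
lemma inv_Gamma_eq_mul (x : ℝ) : (Real.Gamma x)⁻¹ = x * (Real.Gamma (x + 1))⁻¹ := by
  rcases eq_or_ne x 0 with rfl | hx
  · simp
  · rw [Real.Gamma_add_one hx, mul_inv, ← mul_assoc, mul_inv_cancel₀ hx, one_mul]

lemma exists_abs_inv_Gamma_le (ν : ℝ) :
    ∃ C : ℝ, ∀ k : ℕ, |(Real.Gamma (ν + k + 1))⁻¹| ≤ C := by
  obtain ⟨N, hN⟩ := exists_nat_ge (-ν)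
  have hstep : ∀ k : ℕ, |(Real.Gamma (ν + (N + k : ℕ) + 1))⁻¹| ≤
      |(Real.Gamma (ν + N + 1))⁻¹| := by
    intro k
    induction k with
    | zero => simp
    | succ k ih =>
      refine le_trans ?_ ih
      rw [inv_Gamma_eq_mul (ν + (N + k : ℕ) + 1), abs_mul]
      have h1 : 1 ≤ |ν + (N + k : ℕ) + 1| := by
        rw [le_abs]; left; push_cast; nlinarith [Nat.cast_nonneg (α := ℝ) k]
      have e : ν + (N + (k + 1) : ℕ) + 1 = ν + (N + k : ℕ) + 1 + 1 := by push_cast; ring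
      rw [e]
      exact le_mul_of_one_le_left (abs_nonneg _) h1
  refine ⟨∑ k ∈ Finset.range (N + 1), |(Real.Gamma (ν + k + 1))⁻¹|, fun k => ?_⟩
  rcases le_or_gt k N with h | h
  · exact Finset.single_le_sum (f := fun k : ℕ => |(Real.Gamma (ν + k + 1))⁻¹|)
      (fun _ _ => abs_nonneg _) (Finset.mem_range.2 (by omega))
  · obtain ⟨j, rfl⟩ := Nat.exists_eq_add_of_le h.le
    exact (hstep j).trans <| Finset.single_le_sum
      (f := fun k : ℕ => |(Real.Gamma (ν + k + 1))⁻¹|)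
      (fun _ _ => abs_nonneg _) (Finset.mem_range.2 (by omega))

/-- Coefficients of the entire function `z ↦ z^{-ν/2} J_ν(2√z)`. -/
def besselCoeff (ν : ℝ) (k : ℕ) : ℝ := (-1) ^ k / ((k.factorial : ℝ) * Real.Gamma (ν + k + 1))

/-- The entire function `z ↦ z^{-ν/2} J_ν(2√z)`. -/
def besselEntire (ν z : ℝ) : ℝ := ∑' k : ℕ, besselCoeff ν k * z ^ k

/-- The even entire function `(x/2)^{-ν} J_ν(x)`. -/
def besselCore (ν x : ℝ) : ℝ := besselEntire ν ((x / 2) ^ 2)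

lemma exists_abs_besselCoeff_le (ν : ℝ) :
    ∃ C : ℝ, 0 ≤ C ∧ ∀ k : ℕ, |besselCoeff ν k| ≤ C / k.factorial := by
  obtain ⟨C, hC⟩ := exists_abs_inv_Gamma_le ν
  refine ⟨C, (abs_nonneg _).trans (hC 0), fun k => ?_⟩
  rw [besselCoeff, abs_div, abs_pow, abs_neg, abs_one, one_pow, abs_mul, Nat.abs_cast,
    one_div, mul_inv, ← abs_inv, div_eq_inv_mul]
  exact mul_le_mul_of_nonneg_left (hC k) (by positivity)

lemma summable_besselEntire (ν z : ℝ) : Summable fun k : ℕ => besselCoeff ν k * z ^ k := by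
  obtain ⟨C, hC0, hC⟩ := exists_abs_besselCoeff_le ν
  refine Summable.of_norm_bounded (g := fun k : ℕ => C * (|z| ^ k / k.factorial))
    ((Real.summable_pow_div_factorial _).mul_left _) fun k => ?_
  rw [Real.norm_eq_abs, abs_mul, abs_pow]
  calc _ ≤ C / k.factorial * |z| ^ k := mul_le_mul_of_nonneg_right (hC k) (by positivity)
    _ = _ := by ring

lemma besselCoeff_succ (ν : ℝ) (k : ℕ) :
    besselCoeff ν (k + 1) * ((k + 1 : ℕ) : ℝ) = -besselCoeff (ν + 1) k := by
  simp only [besselCoeff, Nat.factorial_succ, pow_succ]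
  have e : ν + (k + 1 : ℕ) + 1 = ν + 1 + k + 1 := by push_cast; ring
  rw [e]
  push_cast
  have h : (k.factorial : ℝ) ≠ 0 := by positivity
  rcases eq_or_ne (Real.Gamma (ν + 1 + k + 1)) 0 with h0 | h0
  · simp [h0]
  · field_simp

lemma besselCoeff_eq_mul (ν : ℝ) (k : ℕ) :
    besselCoeff ν k = (ν + 1 + k) * besselCoeff (ν + 1) k := by
  simp only [besselCoeff, div_eq_mul_inv, mul_inv]
  rw [inv_Gamma_eq_mul (ν + k + 1), show ν + k + 1 + 1 = ν + 1 + k + 1 by ring]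
  ring

lemma hasSum_besselEntire_deriv (ν z : ℝ) :
    HasSum (fun k : ℕ => besselCoeff ν k * (k * z ^ (k - 1))) (-besselEntire (ν + 1) z) := by
  rw [← hasSum_nat_add_iff' 1]
  have h := (summable_besselEntire (ν + 1) z).hasSum.neg
  simp only [Finset.range_one, Finset.sum_singleton, Nat.cast_zero, zero_mul, mul_zero, sub_zero]
  refine h.congr_fun fun k => ?_
  rw [Nat.add_sub_cancel, ← mul_assoc, besselCoeff_succ, neg_mul]

lemma hasDerivAt_besselEntire (ν z : ℝ) :
    HasDerivAt (besselEntire ν) (-besselEntire (ν + 1) z) z := by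
  obtain ⟨C, hC0, hC⟩ := exists_abs_besselCoeff_le (ν + 1)
  rw [← (hasSum_besselEntire_deriv ν z).tsum_eq]
  set R := |z| + 1
  have hu : Summable fun k : ℕ => |besselCoeff ν k| * (k * R ^ (k - 1)) := by
    rw [← summable_nat_add_iff 1]
    refine Summable.of_nonneg_of_le (fun k => by positivity) (fun k => ?_)
      ((Real.summable_pow_div_factorial R).mul_left C)
    rw [Nat.add_sub_cancel, ← mul_assoc]
    have h := besselCoeff_succ ν k
    have h' : |besselCoeff ν (k + 1)| * ((k + 1 : ℕ) : ℝ) = |besselCoeff (ν + 1) k| := by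
      rw [← abs_neg (besselCoeff (ν + 1) k), ← h, abs_mul, Nat.abs_cast]
    rw [h']
    calc _ ≤ C / k.factorial * R ^ k := mul_le_mul_of_nonneg_right (hC k) (by positivity)
      _ = _ := by ring
  refine hasDerivAt_tsum_of_isPreconnected (t := Metric.ball (0 : ℝ) R) (y₀ := 0) hu
    Metric.isOpen_ball (convex_ball _ _).isPreconnected
    (fun k y _ => (hasDerivAt_pow k y).const_mul (besselCoeff ν k)) (fun k y hy => ?_)
    (by simp; positivity) (summable_besselEntire ν 0) (by simp [R])
  rw [Real.norm_eq_abs, abs_mul, abs_mul, Nat.abs_cast, abs_pow]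
  have hy' : |y| ≤ R := by simpa using (mem_ball_zero_iff.1 hy).le
  gcongr

lemma besselEntire_recurrence (ν z : ℝ) :
    besselEntire ν z = (ν + 1) * besselEntire (ν + 1) z - z * besselEntire (ν + 2) z := by
  have h1 := ((summable_besselEntire (ν + 1) z).hasSum.mul_left (ν + 1)).add
    ((hasSum_besselEntire_deriv (ν + 1) z).mul_left z)
  have h2 := (summable_besselEntire ν z).hasSum
  have h3 := h2.unique (h1.congr_fun fun k => ?_)
  · rw [show ν + 1 + 1 = ν + 2 by ring] at h3
    rw [sub_eq_add_neg, ← mul_neg]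
    exact h3
  · rw [besselCoeff_eq_mul]
    rcases k with _ | k
    · simp
    · rw [Nat.add_sub_cancel, pow_succ]; ring

lemma hasDerivAt_besselCore (ν x : ℝ) :
    HasDerivAt (besselCore ν) (-(x / 2) * besselCore (ν + 1) x) x := by
  have h := (hasDerivAt_besselEntire ν ((x / 2) ^ 2)).comp x
    (((hasDerivAt_id x).div_const 2).pow 2)
  refine h.congr_deriv ?_
  simp [besselCore]; ring

lemma continuous_besselCore (ν : ℝ) : Continuous (besselCore ν) :=
  continuous_iff_continuousAt.2 fun x => (hasDerivAt_besselCore ν x).continuousAt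

lemma besselCore_recurrence (ν x : ℝ) :
    besselCore ν x = (ν + 1) * besselCore (ν + 1) x - (x / 2) ^ 2 * besselCore (ν + 2) x :=
  besselEntire_recurrence _ _

lemma besselCore_zero (ν : ℝ) : besselCore ν 0 = (Real.Gamma (ν + 1))⁻¹ := by
  rw [besselCore, besselEntire, tsum_eq_single 0]
  · simp [besselCoeff]
  · intro k hk
    simp [hk]

lemma besselJ_eq_mul_besselCore (ν : ℝ) {x : ℝ} (hx : 0 < x) :
    besselJ ν x = (x / 2) ^ ν * besselCore ν x := by
  rw [besselJ, besselCore, besselEntire, ← tsum_mul_left]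
  refine tsum_congr fun k => ?_
  rw [Real.rpow_add (by positivity), ← pow_mul, show (2 * (k : ℝ)) = ((2 * k : ℕ) : ℝ) by simp,
    Real.rpow_natCast, besselCoeff]
  ring

lemma abs_besselCore_le {ν : ℝ} (hν : -(1 / 2) ≤ ν) {x : ℝ} (hx : 0 ≤ x) :
    |besselCore ν x| ≤ |besselCore ν 0| := by
  have hd : ∀ y : ℝ, HasDerivAt
      (fun y => besselCore ν y ^ 2 + (y / 2) ^ 2 * besselCore (ν + 1) y ^ 2)
      (-(ν + 1 / 2) * y * besselCore (ν + 1) y ^ 2) y := by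
    intro y
    have h := ((hasDerivAt_besselCore ν y).pow 2).add
      ((((hasDerivAt_id y).div_const 2).pow 2).mul ((hasDerivAt_besselCore (ν + 1) y).pow 2))
    refine h.congr_deriv ?_
    have e := besselCore_recurrence ν y
    rw [show ν + 1 + 1 = ν + 2 by ring]
    simp only [Nat.add_one_sub_one, pow_one, Nat.cast_ofNat, id_eq, Pi.pow_apply]
    linear_combination (-y * besselCore (ν + 1) y) * e
  have hanti : AntitoneOn (fun y => besselCore ν y ^ 2 + (y / 2) ^ 2 * besselCore (ν + 1) y ^ 2)
      (Set.Ici 0) := by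
    refine antitoneOn_of_deriv_nonpos (convex_Ici 0)
      (fun y _ => (hd y).continuousAt.continuousWithinAt)
      (fun y _ => (hd y).differentiableAt.differentiableWithinAt) fun y hy => ?_
    rw [interior_Ici] at hy
    rw [(hd y).deriv]
    have hy' : 0 ≤ y := le_of_lt hy
    have : 0 ≤ (ν + 1 / 2) * y * besselCore (ν + 1) y ^ 2 :=
      mul_nonneg (mul_nonneg (by linarith) hy') (sq_nonneg _)
    linarith
  have h := hanti (Set.self_mem_Ici) (Set.mem_Ici.2 hx) hx
  simp only [zero_div, ne_eq, OfNat.ofNat_ne_zero, not_false_eq_true, zero_pow, zero_mul,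
    add_zero] at h
  apply sq_le_sq.1
  nlinarith [mul_nonneg (sq_nonneg (x / 2)) (sq_nonneg (besselCore (ν + 1) x))]

lemma exists_abs_besselCore_le (ν : ℝ) :
    ∃ (C : ℝ) (N : ℕ), 0 ≤ C ∧ ∀ x : ℝ, 0 ≤ x → |besselCore ν x| ≤ C * (1 + x) ^ N := by
  obtain ⟨M, hM⟩ := exists_nat_ge (-(1 / 2) - ν)
  have key : ∀ M : ℕ, ∀ ν : ℝ, -(1 / 2) ≤ ν + M → ∃ (C : ℝ) (N : ℕ), 0 ≤ C ∧
      ∀ x : ℝ, 0 ≤ x → |besselCore ν x| ≤ C * (1 + x) ^ N := by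
    intro M
    induction M with
    | zero =>
      intro ν h
      refine ⟨|besselCore ν 0|, 0, abs_nonneg _, fun x hx => ?_⟩
      simpa using abs_besselCore_le (by simpa using h) hx
    | succ M ih =>
      intro ν h
      push_cast at h
      obtain ⟨C₁, N₁, hC₁, h₁⟩ := ih (ν + 1) (by linarith)
      obtain ⟨C₂, N₂, hC₂, h₂⟩ := ih (ν + 2) (by linarith)
      refine ⟨|ν + 1| * C₁ + C₂, N₁ + N₂ + 2, by positivity, fun x hx => ?_⟩
      rw [besselCore_recurrence]
      have e1 : (1 + x) ^ N₁ ≤ (1 + x) ^ (N₁ + N₂ + 2) :=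
        pow_le_pow_right₀ (by linarith) (by omega)
      have e2 : (x / 2) ^ 2 * (1 + x) ^ N₂ ≤ (1 + x) ^ (N₁ + N₂ + 2) := by
        calc (x / 2) ^ 2 * (1 + x) ^ N₂ ≤ (1 + x) ^ 2 * (1 + x) ^ N₂ := by
              gcongr; linarith
          _ = (1 + x) ^ (N₂ + 2) := by ring
          _ ≤ _ := pow_le_pow_right₀ (by linarith) (by omega)
      calc _ ≤ |(ν + 1) * besselCore (ν + 1) x| + |(x / 2) ^ 2 * besselCore (ν + 2) x| :=
            abs_sub _ _
        _ = |ν + 1| * |besselCore (ν + 1) x| + (x / 2) ^ 2 * |besselCore (ν + 2) x| := by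
            rw [abs_mul, abs_mul, abs_of_nonneg (sq_nonneg (x / 2))]
        _ ≤ |ν + 1| * (C₁ * (1 + x) ^ N₁) + (x / 2) ^ 2 * (C₂ * (1 + x) ^ N₂) := by
            gcongr
            · exact h₁ x hx
            · exact h₂ x hx
        _ = |ν + 1| * C₁ * (1 + x) ^ N₁ + C₂ * ((x / 2) ^ 2 * (1 + x) ^ N₂) := by ring
        _ ≤ |ν + 1| * C₁ * (1 + x) ^ (N₁ + N₂ + 2) + C₂ * (1 + x) ^ (N₁ + N₂ + 2) := by
            gcongr
        _ = _ := by ring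
  exact key M ν (by linarith)

lemma exists_abs_besselCore_le_exp (ν : ℝ) {ε : ℝ} (hε : 0 < ε) :
    ∃ C : ℝ, 0 ≤ C ∧ ∀ x : ℝ, 0 ≤ x → |besselCore ν x| ≤ C * Real.exp (ε * x) := by
  obtain ⟨C, N, hC, h⟩ := exists_abs_besselCore_le ν
  refine ⟨C * (N.factorial / ε ^ N * Real.exp ε), by positivity, fun x hx => ?_⟩
  refine (h x hx).trans ?_
  rw [mul_assoc C, mul_assoc _ (Real.exp ε), ← Real.exp_add]
  refine mul_le_mul_of_nonneg_left ?_ hC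
  have h1 := Real.pow_div_factorial_le_exp (ε * (1 + x)) (by positivity) N
  rw [mul_pow, div_le_iff₀ (by positivity)] at h1
  rw [div_mul_eq_mul_div, le_div_iff₀ (by positivity)]
  calc _ = ε ^ N * (1 + x) ^ N := by ring
    _ ≤ _ := h1
    _ = _ := by rw [show ε * (1 + x) = ε + ε * x by ring]; ring

/-- The Laplace transform of `x^{p-1} (x/2)^{-ν} J_ν(x)`. -/
def besselLaplace (ν p s : ℝ) : ℝ :=
  ∫ x in Set.Ioi (0 : ℝ), Real.exp (-(s * x)) * x ^ (p - 1) * besselCore ν x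

lemma continuousOn_besselLaplace_integrand (ν p s : ℝ) :
    ContinuousOn (fun x : ℝ => Real.exp (-(s * x)) * x ^ (p - 1) * besselCore ν x)
      (Set.Ioi 0) := by
  refine ContinuousOn.mul (ContinuousOn.mul (by fun_prop) ?_)
    (continuous_besselCore ν).continuousOn
  exact fun x hx => (Real.continuousAt_rpow_const x _ (Or.inl (ne_of_gt hx))).continuousWithinAt

lemma integrableOn_exp_mul_rpow {p s : ℝ} (hp : 0 < p) (hs : 0 < s) :
    IntegrableOn (fun x : ℝ => Real.exp (-(s * x)) * x ^ (p - 1)) (Set.Ioi 0) := by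
  have h := integrableOn_rpow_mul_exp_neg_mul_rpow (p := 1) (s := p - 1) (b := s)
    (by linarith) one_pos hs
  refine h.congr_fun (fun x _ => ?_) measurableSet_Ioi
  simp only [Real.rpow_one, neg_mul]
  ring

lemma integrableOn_besselLaplace (ν : ℝ) {p s : ℝ} (hp : 0 < p) (hs : 0 < s) :
    IntegrableOn (fun x : ℝ => Real.exp (-(s * x)) * x ^ (p - 1) * besselCore ν x)
      (Set.Ioi 0) := by
  obtain ⟨C, hC, h⟩ := exists_abs_besselCore_le_exp ν (half_pos hs)
  refine Integrable.mono' ((integrableOn_exp_mul_rpow hp (half_pos hs)).mul_const C)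
    ((continuousOn_besselLaplace_integrand ν p s).aestronglyMeasurable measurableSet_Ioi) ?_
  refine (ae_restrict_iff' measurableSet_Ioi).2 (ae_of_all _ fun x hx => ?_)
  have hx' : 0 < x := hx
  rw [Real.norm_eq_abs, abs_mul, abs_of_nonneg (by positivity)]
  calc _ ≤ Real.exp (-(s * x)) * x ^ (p - 1) * (C * Real.exp (s / 2 * x)) := by
        gcongr; exact h x hx'.le
    _ = (Real.exp (-(s * x)) * Real.exp (s / 2 * x)) * x ^ (p - 1) * C := by ring
    _ = _ := by rw [← Real.exp_add]; ring_nf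

lemma besselLaplace_by_parts (ν : ℝ) {p s : ℝ} (hp : 0 < p) (hs : 0 < s) :
    s * besselLaplace ν (p + 1) s =
      p * besselLaplace ν p s - besselLaplace (ν + 1) (p + 2) s / 2 := by
  have i1 := integrableOn_besselLaplace ν (p := p + 1) (by linarith) hs
  have i2 := integrableOn_besselLaplace ν hp hs
  have i3 := integrableOn_besselLaplace (ν + 1) (p := p + 2) (by linarith) hs
  have hint := ((i1.const_mul (-s)).add (i2.const_mul p)).add (i3.const_mul (-(1 / 2)))
  have hlim : Tendsto (fun x : ℝ => Real.exp (-(s * x)) * x ^ p * besselCore ν x) atTop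
      (nhds 0) := by
    obtain ⟨C, hC, h⟩ := exists_abs_besselCore_le_exp ν (half_pos hs)
    have h0 := (tendsto_rpow_mul_exp_neg_mul_atTop_nhds_zero p (s / 2) (half_pos hs)).mul_const C
    rw [zero_mul] at h0
    refine squeeze_zero_norm' ?_ h0
    filter_upwards [eventually_gt_atTop 0] with x hx
    rw [Real.norm_eq_abs, abs_mul, abs_of_nonneg (by positivity)]
    calc _ ≤ Real.exp (-(s * x)) * x ^ p * (C * Real.exp (s / 2 * x)) := by
          gcongr; exact h x hx.le
      _ = x ^ p * (Real.exp (-(s * x)) * Real.exp (s / 2 * x)) * C := by ring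
      _ = _ := by rw [← Real.exp_add]; ring_nf
  have hftc := integral_Ioi_of_hasDerivAt_of_tendsto
    (f := fun x : ℝ => Real.exp (-(s * x)) * x ^ p * besselCore ν x) (a := 0) ?_ ?_ hint hlim
  · simp only [Real.zero_rpow hp.ne', mul_zero, zero_mul, sub_zero] at hftc
    rw [integral_add' ((i1.const_mul (-s)).add (i2.const_mul p)) (i3.const_mul (-(1 / 2))),
      integral_add' (i1.const_mul (-s)) (i2.const_mul p), integral_const_mul, integral_const_mul,
      integral_const_mul] at hftc
    simp only [besselLaplace]
    linarith
  · refine ContinuousAt.continuousWithinAt ?_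
    refine ContinuousAt.mul (ContinuousAt.mul (by fun_prop) ?_)
      (continuous_besselCore ν).continuousAt
    exact Real.continuousAt_rpow_const _ _ (Or.inr hp.le)
  · intro x hx
    have hx' : 0 < x := hx
    have h1 : HasDerivAt (fun x : ℝ => Real.exp (-(s * x))) (Real.exp (-(s * x)) * -s) x := by
      have := ((hasDerivAt_id x).const_mul s).neg.exp
      simpa using this
    have h := (h1.mul (Real.hasDerivAt_rpow_const (p := p) (Or.inl hx'.ne'))).mul
      (hasDerivAt_besselCore ν x)
    refine h.congr_deriv ?_
    simp only [Pi.add_apply, Pi.mul_apply]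
    rw [show p + 2 - 1 = p + 1 by ring, Real.rpow_add_one hx'.ne', show p + 1 - 1 = p by ring]
    ring

lemma besselLaplace_raise_order (ν : ℝ) {p s : ℝ} (hp : 0 < p) (hs : 0 < s) :
    besselLaplace ν p s = (ν + 1 - p / 2) * besselLaplace (ν + 1) p s +
      s / 2 * besselLaplace (ν + 1) (p + 1) s := by
  have h1 := besselLaplace_by_parts (ν + 1) hp hs
  have i1 := integrableOn_besselLaplace (ν + 1) hp hs
  have i2 := integrableOn_besselLaplace (ν + 2) (p := p + 2) (by linarith) hs
  have h2 : besselLaplace ν p s =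
      (ν + 1) * besselLaplace (ν + 1) p s - 1 / 4 * besselLaplace (ν + 2) (p + 2) s := by
    simp only [besselLaplace]
    rw [← integral_const_mul, ← integral_const_mul,
      ← integral_sub (i1.const_mul _) (i2.const_mul _)]
    refine setIntegral_congr_fun measurableSet_Ioi fun x hx => ?_
    have hx' : 0 < x := hx
    rw [besselCore_recurrence ν x, show p + 2 - 1 = p - 1 + 1 + 1 by ring,
      Real.rpow_add_one hx'.ne', Real.rpow_add_one hx'.ne']
    ring
  rw [show ν + 1 + 1 = ν + 2 by ring] at h1
  rw [h2]
  linarith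

lemma hasDerivAt_besselLaplace (ν : ℝ) {p s : ℝ} (hp : 0 < p) (hs : 0 < s) :
    HasDerivAt (besselLaplace ν p) (-besselLaplace ν (p + 1) s) s := by
  have key := hasDerivAt_integral_of_dominated_loc_of_deriv_le
    (μ := volume.restrict (Set.Ioi (0 : ℝ))) (x₀ := s) (s := Set.Ioi (s / 2))
    (F := fun s x => Real.exp (-(s * x)) * x ^ (p - 1) * besselCore ν x)
    (F' := fun s x => -(Real.exp (-(s * x)) * x ^ (p + 1 - 1) * besselCore ν x))
    (bound := fun x => |Real.exp (-(s / 2 * x)) * x ^ (p + 1 - 1) * besselCore ν x|)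
    (Ioi_mem_nhds (by linarith))
    (Eventually.of_forall fun r =>
      (continuousOn_besselLaplace_integrand ν p r).aestronglyMeasurable measurableSet_Ioi)
    (integrableOn_besselLaplace ν hp hs)
    ((continuousOn_besselLaplace_integrand ν (p + 1) s).neg.aestronglyMeasurable
      measurableSet_Ioi)
    ((ae_restrict_iff' measurableSet_Ioi).2 (ae_of_all _ fun x hx r hr => ?_))
    (integrableOn_besselLaplace ν (p := p + 1) (by linarith) (half_pos hs)).abs
    ((ae_restrict_iff' measurableSet_Ioi).2 (ae_of_all _ fun x hx r hr => ?_))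
  · have := key.2
    rw [integral_neg] at this
    exact this
  · have hx' : 0 < x := hx
    have hr' : s / 2 < r := hr
    have h1 : ∀ t : ℝ, |Real.exp (-(t * x)) * x ^ (p + 1 - 1)| =
        Real.exp (-(t * x)) * x ^ (p + 1 - 1) := fun t => abs_of_nonneg (by positivity)
    rw [norm_neg, Real.norm_eq_abs, abs_mul, abs_mul _ (besselCore ν x), h1, h1]
    gcongr
  · have hx' : 0 < x := hx
    have h1 : HasDerivAt (fun r : ℝ => Real.exp (-(r * x))) (Real.exp (-(r * x)) * -x) r := by
      have := ((hasDerivAt_id r).mul_const x).neg.exp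
      simpa using this
    refine ((h1.mul_const _).mul_const _).congr_deriv ?_
    rw [show p + 1 - 1 = p - 1 + 1 by ring, Real.rpow_add_one hx'.ne']
    ring

lemma tendsto_rpow_mul_besselLaplace {lam : ℝ} (h : -(1 / 2) < lam) :
    Tendsto (fun s : ℝ => s ^ (2 * lam + 1) * besselLaplace lam (2 * lam + 1) s) atTop
      (nhds (Real.Gamma (2 * lam + 1) / Real.Gamma (lam + 1))) := by
  have hp : 0 < 2 * lam + 1 := by linarith
  have hlim : Tendsto (fun s : ℝ => ∫ u in Set.Ioi (0 : ℝ),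
      Real.exp (-(1 * u)) * u ^ (2 * lam + 1 - 1) * besselCore lam (s⁻¹ * u)) atTop
      (nhds (∫ u in Set.Ioi (0 : ℝ),
        Real.exp (-(1 * u)) * u ^ (2 * lam + 1 - 1) * besselCore lam 0)) := by
    refine tendsto_integral_filter_of_dominated_convergence
      (fun u => Real.exp (-(1 * u)) * u ^ (2 * lam + 1 - 1) * |besselCore lam 0|) ?_ ?_
      ((integrableOn_exp_mul_rpow hp one_pos).mul_const _) ?_
    · refine Eventually.of_forall fun s => ?_
      refine ((integrableOn_exp_mul_rpow hp one_pos).aestronglyMeasurable).mul ?_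
      exact ((continuous_besselCore lam).comp (continuous_const_mul _)).aestronglyMeasurable
    · filter_upwards [eventually_gt_atTop 0] with s hs
      refine (ae_restrict_iff' measurableSet_Ioi).2 (ae_of_all _ fun u hu => ?_)
      have hu' : 0 < u := hu
      rw [Real.norm_eq_abs, abs_mul, abs_of_nonneg (by positivity)]
      exact mul_le_mul_of_nonneg_left (abs_besselCore_le h.le (by positivity)) (by positivity)
    · refine ae_of_all _ fun u => Tendsto.const_mul _ ?_
      have h0 : Tendsto (fun s : ℝ => s⁻¹ * u) atTop (nhds 0) := by
        simpa using tendsto_inv_atTop_zero.mul_const u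
      exact (continuous_besselCore lam).continuousAt.tendsto.comp h0
  have hval : (∫ u in Set.Ioi (0 : ℝ),
      Real.exp (-(1 * u)) * u ^ (2 * lam + 1 - 1) * besselCore lam 0) =
      Real.Gamma (2 * lam + 1) / Real.Gamma (lam + 1) := by
    rw [integral_mul_const, besselCore_zero, Real.Gamma_eq_integral hp, div_eq_mul_inv]
    simp only [one_mul]
  rw [hval] at hlim
  refine hlim.congr' ?_
  filter_upwards [eventually_gt_atTop 0] with s hs
  have hsub := integral_comp_mul_left_Ioi (fun u : ℝ => Real.exp (-(1 * u)) *
    u ^ (2 * lam + 1 - 1) * besselCore lam (s⁻¹ * u)) 0 hs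
  rw [mul_zero, smul_eq_mul, eq_inv_mul_iff_mul_eq₀ hs.ne'] at hsub
  rw [← hsub, besselLaplace, ← integral_const_mul, ← integral_const_mul]
  refine setIntegral_congr_fun measurableSet_Ioi fun x hx => ?_
  have hx' : 0 < x := hx
  rw [Real.mul_rpow hs.le hx'.le, inv_mul_cancel_left₀ hs.ne', one_mul,
    show s ^ (2 * lam + 1) = s ^ (2 * lam + 1 - 1) * s by
      rw [← Real.rpow_add_one hs.ne']; ring_nf]
  ring

/-- Lipschitz–Hankel type evaluation `∫₀^∞ e^{-sx} x^λ J_λ(x) dx = C (1+s²)^{-λ-1/2}`. -/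
lemma besselLaplace_eq {lam s : ℝ} (h : -(1 / 2) < lam) (hs : 0 < s) :
    besselLaplace lam (2 * lam + 1) s =
      Real.Gamma (2 * lam + 1) / Real.Gamma (lam + 1) * (1 + s ^ 2) ^ (-(lam + 1 / 2)) := by
  have hp : 0 < 2 * lam + 1 := by linarith
  set G : ℝ → ℝ := fun s => (1 + s ^ 2) ^ (lam + 1 / 2) * besselLaplace lam (2 * lam + 1) s
  have hG : ∀ s ∈ Set.Ioi (0 : ℝ), HasDerivAt G 0 s := by
    intro s hs
    have hs' : 0 < s := hs
    have hpos : 0 < 1 + s ^ 2 := by positivity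
    have hb : HasDerivAt (fun s : ℝ => 1 + s ^ 2) (2 * s) s := by
      simpa using (hasDerivAt_pow 2 s).const_add 1
    have h1 := hb.rpow_const (p := lam + 1 / 2) (Or.inl hpos.ne')
    refine (h1.mul (hasDerivAt_besselLaplace lam hp hs')).congr_deriv ?_
    have e1 := besselLaplace_by_parts lam hp hs'
    have e2 := besselLaplace_raise_order lam (p := 2 * lam + 1 + 1) (by linarith) hs'
    rw [show 2 * lam + 1 + 1 + 1 = 2 * lam + 1 + 2 by ring] at e2
    rw [show (1 + s ^ 2) ^ (lam + 1 / 2) = (1 + s ^ 2) ^ (lam + 1 / 2 - 1) * (1 + s ^ 2) by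
      rw [← Real.rpow_add_one hpos.ne']; ring_nf]
    linear_combination (-(1 + s ^ 2) ^ (lam + 1 / 2 - 1)) * (s * e1 + e2)
  have hconst : ∀ t ∈ Set.Ioi (0 : ℝ), G t = G s := fun t ht =>
    isOpen_Ioi.is_const_of_deriv_eq_zero isPreconnected_Ioi
      (fun x hx => (hG x hx).differentiableAt.differentiableWithinAt)
      (fun x hx => (hG x hx).deriv) ht hs
  have hlim : Tendsto G atTop (nhds (Real.Gamma (2 * lam + 1) / Real.Gamma (lam + 1))) := by
    have h1 : Tendsto (fun t : ℝ => (1 + (t⁻¹) ^ 2) ^ (lam + 1 / 2)) atTop (nhds 1) := by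
      have h0 : Tendsto (fun t : ℝ => 1 + (t⁻¹) ^ 2) atTop (nhds 1) := by
        simpa using (tendsto_inv_atTop_zero (𝕜 := ℝ)).pow 2 |>.const_add 1
      simpa using h0.rpow_const (p := lam + 1 / 2) (Or.inl one_ne_zero)
    have h2 := h1.mul (tendsto_rpow_mul_besselLaplace h)
    rw [one_mul] at h2
    refine h2.congr' ?_
    filter_upwards [eventually_gt_atTop 0] with t ht
    rw [← mul_assoc]
    congr 1
    rw [show 2 * lam + 1 = 2 * (lam + 1 / 2) by ring, Real.rpow_mul ht.le, Real.rpow_two,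
      ← Real.mul_rpow (by positivity) (by positivity)]
    congr 1
    field_simp
    ring
  have hGs : G s = Real.Gamma (2 * lam + 1) / Real.Gamma (lam + 1) := by
    refine tendsto_nhds_unique (tendsto_const_nhds.congr' ?_) hlim
    filter_upwards [eventually_gt_atTop 0] with t ht
    exact (hconst t ht).symm
  have hpos : 0 < 1 + s ^ 2 := by positivity
  rw [← hGs, Real.rpow_neg hpos.le]
  have := (Real.rpow_pos_of_pos hpos (lam + 1 / 2)).ne'
  simp only [G]
  field_simp

/-- The limit as `s → 0⁺` of `besselLaplace ν (2ν+1+N) s`. -/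
def besselMoment : ℕ → ℝ → ℝ
  | 0, ν => Real.Gamma (2 * ν + 1) / Real.Gamma (ν + 1)
  | 1, _ => 0
  | N + 2, ν => -((N + 1 : ℝ) / 2) * besselMoment N (ν + 1)

lemma tendsto_besselLaplace (N : ℕ) : ∀ ν : ℝ, 0 < 2 * ν + 1 + N →
    Tendsto (besselLaplace ν (2 * ν + 1 + N)) (nhdsWithin 0 (Set.Ioi 0))
      (nhds (besselMoment N ν)) := by
  have hid : Tendsto (fun s : ℝ => s / 2) (nhdsWithin 0 (Set.Ioi 0)) (nhds 0) := by
    have : Tendsto (fun s : ℝ => s / 2) (nhds 0) (nhds (0 / 2)) :=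
      tendsto_id.div_const 2
    rw [zero_div] at this
    exact this.mono_left nhdsWithin_le_nhds
  have base : ∀ ν : ℝ, 0 < 2 * ν + 1 →
      Tendsto (besselLaplace ν (2 * ν + 1)) (nhdsWithin 0 (Set.Ioi 0))
      (nhds (besselMoment 0 ν)) := by
    intro ν hν
    have h1 : Tendsto (fun s : ℝ => Real.Gamma (2 * ν + 1) / Real.Gamma (ν + 1) *
        (1 + s ^ 2) ^ (-(ν + 1 / 2))) (nhdsWithin 0 (Set.Ioi 0)) (nhds (besselMoment 0 ν)) := by
      have h0 : Tendsto (fun s : ℝ => 1 + s ^ 2) (nhds 0) (nhds 1) := by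
        simpa using (tendsto_id (x := nhds (0 : ℝ))).pow 2 |>.const_add 1
      have := (h0.rpow_const (p := -(ν + 1 / 2)) (Or.inl one_ne_zero)).const_mul
        (Real.Gamma (2 * ν + 1) / Real.Gamma (ν + 1))
      rw [Real.one_rpow, mul_one] at this
      exact this.mono_left nhdsWithin_le_nhds
    refine h1.congr' ?_
    filter_upwards [self_mem_nhdsWithin] with s hs
    exact (besselLaplace_eq (by linarith) hs).symm
  induction N using Nat.strong_induction_on with
  | _ N ih =>
    intro ν hν
    rcases N with _ | _ | N
    · simpa using base ν (by simpa using hν)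
    · have h1 := hid.mul (base (ν + 1) (by push_cast at hν; linarith))
      rw [zero_mul] at h1
      refine h1.congr' ?_
      filter_upwards [self_mem_nhdsWithin] with s hs
      rw [besselLaplace_raise_order ν hν hs]
      push_cast
      rw [show 2 * (ν + 1) + 1 = 2 * ν + 1 + (0 + 1) + 1 by ring]
      ring_nf
    · have h0 := ih N (by omega) (ν + 1) (by push_cast at hν; linarith)
      have h1 := ih (N + 1) (by omega) (ν + 1) (by push_cast at hν ⊢; linarith)
      have h2 := (h0.const_mul (-((N + 1 : ℝ) / 2))).add (hid.mul h1)
      rw [zero_mul, add_zero] at h2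
      refine h2.congr' ?_
      filter_upwards [self_mem_nhdsWithin] with s hs
      rw [besselLaplace_raise_order ν hν hs]
      push_cast
      rw [show 2 * (ν + 1) + 1 + (N : ℝ) = 2 * ν + 1 + (N + 1 + 1) by ring,
        show 2 * (ν + 1) + 1 + ((N : ℝ) + 1) = 2 * ν + 1 + (N + 1 + 1) + 1 by ring]
      ring

lemma besselMoment_odd (M : ℕ) (ν : ℝ) : besselMoment (2 * M + 1) ν = 0 := by
  induction M generalizing ν with
  | zero => rfl
  | succ M ih =>
    rw [show 2 * (M + 1) + 1 = 2 * M + 1 + 2 by ring, besselMoment, ih, mul_zero]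

lemma besselMoment_even_ne_zero (M : ℕ) (ν : ℝ) (h : 0 < 2 * ν + 1 + 2 * M) :
    besselMoment (2 * M) ν ≠ 0 := by
  induction M generalizing ν with
  | zero =>
    simp only [Nat.cast_zero, mul_zero, add_zero] at h
    exact (div_pos (Real.Gamma_pos_of_pos h) (Real.Gamma_pos_of_pos (by linarith))).ne'
  | succ M ih =>
    rw [show 2 * (M + 1) = 2 * M + 2 by ring, besselMoment]
    push_cast at h
    exact mul_ne_zero (neg_ne_zero.2 (by positivity)) (ih _ (by linarith))

lemma besselMoment_even_succ (M : ℕ) (ν : ℝ) (h : 0 < 2 * ν + 1 + 2 * M) :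
    besselMoment (2 * (M + 1)) ν =
      -((2 * M + 1) * (2 * ν + 2 * M + 1)) * besselMoment (2 * M) ν := by
  induction M generalizing ν with
  | zero =>
    simp only [Nat.cast_zero, mul_zero, add_zero] at h
    simp only [zero_add, mul_zero, besselMoment, Nat.cast_zero]
    rw [show 2 * (ν + 1) + 1 = 2 * ν + 1 + 1 + 1 by ring, Real.Gamma_add_one (by linarith),
      Real.Gamma_add_one (s := 2 * ν + 1) (by linarith), Real.Gamma_add_one (s := ν + 1)
      (by linarith)]
    have h1 : ν + 1 ≠ 0 := by linarith
    have h2 := (Real.Gamma_pos_of_pos (show 0 < ν + 1 by linarith)).ne'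
    field_simp
    ring
  | succ M ih =>
    push_cast at h
    rw [show 2 * (M + 1 + 1) = 2 * (M + 1) + 2 by ring, besselMoment, ih _ (by linarith),
      show 2 * (M + 1) = 2 * M + 2 by ring, besselMoment]
    push_cast
    ring

lemma cosh_rpow_mul_cosh_le (ν : ℝ) {p t : ℝ} (hp : 0 ≤ p) (ht : 0 ≤ t) :
    Real.cosh t ^ (-p) * Real.cosh (ν * t) ≤ 2 ^ p * Real.exp (-(p - |ν|) * t) := by
  have h1 : Real.exp t / 2 ≤ Real.cosh t := by
    rw [Real.cosh_eq]; linarith [Real.exp_pos (-t)]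
  have h2 : Real.cosh t ^ (-p) ≤ 2 ^ p * Real.exp (-(p * t)) := by
    calc _ ≤ (Real.exp t / 2) ^ (-p) :=
          Real.rpow_le_rpow_of_nonpos (by positivity) h1 (by linarith)
      _ = _ := by
          rw [Real.rpow_neg (by positivity), Real.div_rpow (by positivity) (by positivity),
            ← Real.exp_mul, inv_div, div_eq_mul_inv, ← Real.exp_neg, mul_comm t p]
  have h3 : Real.cosh (ν * t) ≤ Real.exp (|ν| * t) := by
    rw [← Real.cosh_abs, abs_mul, abs_of_nonneg ht, Real.cosh_eq]
    have : Real.exp (-(|ν| * t)) ≤ Real.exp (|ν| * t) :=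
      Real.exp_le_exp.2 (by nlinarith [abs_nonneg ν, mul_nonneg (abs_nonneg ν) ht])
    linarith
  calc _ ≤ 2 ^ p * Real.exp (-(p * t)) * Real.exp (|ν| * t) :=
        mul_le_mul h2 h3 (Real.cosh_pos _).le (by positivity)
    _ = _ := by rw [mul_assoc, ← Real.exp_add]; ring_nf

lemma continuous_cosh_rpow (p : ℝ) : Continuous fun t : ℝ => Real.cosh t ^ p :=
  Real.continuous_cosh.rpow_const fun t => Or.inl (Real.cosh_pos t).ne'

lemma integrableOn_cosh_rpow_mul_cosh {ν p : ℝ} (h : |ν| < p) :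
    IntegrableOn (fun t : ℝ => Real.cosh t ^ (-p) * Real.cosh (ν * t)) (Set.Ioi 0) := by
  have hp : 0 ≤ p := (abs_nonneg ν).trans h.le
  refine Integrable.mono' ((exp_neg_integrableOn_Ioi 0 (sub_pos.2 h)).const_mul (2 ^ p))
    ((continuous_cosh_rpow (-p)).mul (by fun_prop)).aestronglyMeasurable ?_
  refine (ae_restrict_iff' measurableSet_Ioi).2 (ae_of_all _ fun t ht => ?_)
  have := Real.cosh_pos t
  have := Real.cosh_pos (ν * t)
  rw [Real.norm_eq_abs, abs_of_nonneg (by positivity)]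
  exact cosh_rpow_mul_cosh_le ν hp (le_of_lt ht)

lemma abs_sinh_le_cosh (t : ℝ) : |Real.sinh t| ≤ Real.cosh t := by
  rw [Real.abs_sinh, ← Real.cosh_abs t]
  exact (Real.sinh_lt_cosh _).le

lemma integral_cosh_rpow_recurrence {ν p : ℝ} (h : |ν| < p) :
    p * (p + 1) * ∫ t in Set.Ioi (0 : ℝ), Real.cosh t ^ (-(p + 2)) * Real.cosh (ν * t) =
      (p ^ 2 - ν ^ 2) * ∫ t in Set.Ioi (0 : ℝ), Real.cosh t ^ (-p) * Real.cosh (ν * t) := by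
  have hp : 0 ≤ p := (abs_nonneg ν).trans h.le
  have i1 := integrableOn_cosh_rpow_mul_cosh h
  have i2 := integrableOn_cosh_rpow_mul_cosh (ν := ν) (p := p + 2) (by linarith)
  have hint := (i1.const_mul (ν ^ 2 - p ^ 2)).add (i2.const_mul (p * (p + 1)))
  set f : ℝ → ℝ := fun t => Real.cosh t ^ (-p) * (ν * Real.sinh (ν * t)) +
    p * (Real.cosh t ^ (-p - 1) * Real.sinh t) * Real.cosh (ν * t)
  have hd : ∀ t : ℝ, HasDerivAt f ((ν ^ 2 - p ^ 2) * (Real.cosh t ^ (-p) * Real.cosh (ν * t)) +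
      p * (p + 1) * (Real.cosh t ^ (-(p + 2)) * Real.cosh (ν * t))) t := by
    intro t
    have hc := Real.cosh_pos t
    have a1 := (Real.hasDerivAt_cosh t).rpow_const (p := -p) (Or.inl hc.ne')
    have a2 := (Real.hasDerivAt_cosh t).rpow_const (p := -p - 1) (Or.inl hc.ne')
    have hl : HasDerivAt (fun t : ℝ => ν * t) ν t := by
      simpa using (hasDerivAt_id t).const_mul ν
    have hd := (a1.mul (hl.sinh.const_mul ν)).add
      (((a2.mul (Real.hasDerivAt_sinh t)).const_mul p).mul hl.cosh)
    refine hd.congr_deriv ?_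
    have e1 : Real.cosh t ^ (-p - 1) = Real.cosh t ^ (-p - 1 - 1) * Real.cosh t := by
      rw [← Real.rpow_add_one hc.ne']; ring_nf
    have e0 : Real.cosh t ^ (-p) = Real.cosh t ^ (-p - 1 - 1) * Real.cosh t * Real.cosh t := by
      rw [← e1, ← Real.rpow_add_one hc.ne']; ring_nf
    rw [show -(p + 2) = -p - 1 - 1 by ring]
    simp only [Pi.mul_apply]
    rw [e0, e1]
    have hs := Real.cosh_sq t
    have hs' : Real.sinh t ^ 2 = Real.cosh t ^ 2 - 1 := by linarith
    linear_combination
      (-(p * (p + 1)) * Real.cosh t ^ (-p - 1 - 1) * Real.cosh (ν * t)) * hs'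
  have hlim : Tendsto f atTop (nhds 0) := by
    have h0 : Tendsto (fun t : ℝ => (|ν| + p) * (2 ^ p * Real.exp (-(p - |ν|) * t))) atTop
        (nhds 0) := by
      have : Tendsto (fun t : ℝ => -(p - |ν|) * t) atTop atBot :=
        tendsto_id.const_mul_atTop_of_neg (by linarith)
      simpa using ((Real.tendsto_exp_atBot.comp this).const_mul (2 ^ p)).const_mul (|ν| + p)
    refine squeeze_zero_norm' ?_ h0
    filter_upwards [eventually_ge_atTop 0] with t ht
    have hc := Real.cosh_pos t
    have hc' := Real.cosh_pos (ν * t)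
    refine le_trans ?_ (mul_le_mul_of_nonneg_left (cosh_rpow_mul_cosh_le ν hp ht)
      (by positivity))
    have e : Real.cosh t ^ (-p) = Real.cosh t ^ (-p - 1) * Real.cosh t := by
      rw [← Real.rpow_add_one hc.ne']; ring_nf
    calc ‖f t‖ ≤ |Real.cosh t ^ (-p) * (ν * Real.sinh (ν * t))| +
          |p * (Real.cosh t ^ (-p - 1) * Real.sinh t) * Real.cosh (ν * t)| := norm_add_le _ _
      _ = Real.cosh t ^ (-p) * (|ν| * |Real.sinh (ν * t)|) +
          p * (Real.cosh t ^ (-p - 1) * |Real.sinh t|) * Real.cosh (ν * t) := by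
          simp only [abs_mul, abs_of_pos hc', abs_of_nonneg hp,
            abs_of_pos (Real.rpow_pos_of_pos hc _)]
      _ ≤ Real.cosh t ^ (-p) * (|ν| * Real.cosh (ν * t)) +
          p * (Real.cosh t ^ (-p - 1) * Real.cosh t) * Real.cosh (ν * t) := by
          gcongr
          · exact abs_sinh_le_cosh _
          · exact abs_sinh_le_cosh _
      _ = _ := by rw [← e]; ring
  have hftc := integral_Ioi_of_hasDerivAt_of_tendsto (f := f) (a := 0)
    (hd 0).continuousAt.continuousWithinAt (fun t _ => hd t) hint hlim
  have hf0 : f 0 = 0 := by simp [f]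
  rw [hf0, sub_zero, integral_add (i1.const_mul _) (i2.const_mul _), integral_const_mul,
    integral_const_mul] at hftc
  linarith

lemma integrableOn_besselK_integrand (ν : ℝ) {x : ℝ} (hx : 0 < x) :
    IntegrableOn (fun t : ℝ => Real.exp (-x * Real.cosh t) * Real.cosh (ν * t)) (Set.Ioi 0) := by
  obtain ⟨N, hN⟩ := exists_nat_gt |ν|
  refine Integrable.mono' ((integrableOn_cosh_rpow_mul_cosh hN).const_mul (N.factorial / x ^ N))
    (by fun_prop) (ae_of_all _ fun t => ?_)
  have hc := Real.cosh_pos t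
  have hc' := Real.cosh_pos (ν * t)
  rw [Real.norm_eq_abs, abs_of_nonneg (by positivity), ← mul_assoc]
  refine mul_le_mul_of_nonneg_right ?_ hc'.le
  have h := Real.pow_div_factorial_le_exp (x * Real.cosh t) (by positivity) N
  rw [neg_mul, Real.exp_neg, Real.rpow_neg hc.le, Real.rpow_natCast]
  calc (Real.exp (x * Real.cosh t))⁻¹ ≤ ((x * Real.cosh t) ^ N / N.factorial)⁻¹ := by gcongr
    _ = _ := by rw [inv_div, mul_pow]; field_simp

lemma besselK_pos (ν : ℝ) {x : ℝ} (hx : 0 < x) : 0 < besselK ν x := by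
  rw [besselK, setIntegral_pos_iff_support_of_nonneg_ae
    (ae_of_all _ fun t => by have := Real.cosh_pos (ν * t); positivity)
    (integrableOn_besselK_integrand ν hx)]
  have : (Function.support fun t : ℝ => Real.exp (-x * Real.cosh t) * Real.cosh (ν * t)) =
      Set.univ := by
    refine Set.eq_univ_of_forall fun t => ?_
    have := Real.cosh_pos (ν * t)
    exact (by positivity : (0 : ℝ) < Real.exp (-x * Real.cosh t) * Real.cosh (ν * t)).ne'
  rw [this, Set.univ_inter]
  simp

lemma integral_rpow_mul_exp_neg_mul_cosh (ν t : ℝ) {a : ℝ} (ha : -1 < a) :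
    ∫ y in Set.Ioi (0 : ℝ), y ^ a * (Real.exp (-y * Real.cosh t) * Real.cosh (ν * t)) =
      Real.Gamma (a + 1) * (Real.cosh t ^ (-(a + 1)) * Real.cosh (ν * t)) := by
  have hc := Real.cosh_pos t
  have h := Real.integral_rpow_mul_exp_neg_mul_Ioi (a := a + 1) (by linarith) hc
  rw [one_div, Real.inv_rpow hc.le, ← Real.rpow_neg hc.le, add_sub_cancel_right] at h
  rw [← mul_assoc, mul_comm (Real.Gamma _), ← h, ← integral_mul_const]
  refine integral_congr_ae (ae_of_all _ fun y => ?_)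
  simp only [neg_mul, mul_comm (Real.cosh t) y]
  ring

lemma integrable_besselK_kernel {ν a : ℝ} (h : |ν| < a + 1) :
    Integrable (fun z : ℝ × ℝ => z.1 ^ a * (Real.exp (-z.1 * Real.cosh z.2) *
      Real.cosh (ν * z.2)))
      ((volume.restrict (Set.Ioi (0 : ℝ))).prod (volume.restrict (Set.Ioi (0 : ℝ)))) := by
  have ha : -1 < a := by linarith [abs_nonneg ν]
  rw [integrable_prod_iff' (by fun_prop)]
  constructor
  · refine ae_of_all _ fun t => ?_
    have h1 := (integrableOn_exp_mul_rpow (p := a + 1) (by linarith)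
      (Real.cosh_pos t)).mul_const (Real.cosh (ν * t))
    refine h1.congr (ae_of_all _ fun y => ?_)
    simp only [add_sub_cancel_right, neg_mul, mul_comm (Real.cosh t) y]
    ring
  · refine ((integrableOn_cosh_rpow_mul_cosh h).const_mul (Real.Gamma (a + 1))).congr
      (ae_of_all _ fun t => ?_)
    simp only
    rw [← integral_rpow_mul_exp_neg_mul_cosh ν t ha]
    refine setIntegral_congr_fun measurableSet_Ioi fun y hy => ?_
    have hy' : 0 < y := hy
    have := Real.cosh_pos (ν * t)
    exact (Real.norm_of_nonneg (by positivity)).symm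

lemma integrableOn_rpow_mul_besselK {ν a : ℝ} (h : |ν| < a + 1) :
    IntegrableOn (fun y : ℝ => y ^ a * besselK ν y) (Set.Ioi 0) := by
  refine (integrable_besselK_kernel h).integral_prod_left.congr (ae_of_all _ fun y => ?_)
  exact integral_const_mul (y ^ a) _

lemma integral_rpow_mul_besselK {ν a : ℝ} (h : |ν| < a + 1) :
    ∫ y in Set.Ioi (0 : ℝ), y ^ a * besselK ν y =
      Real.Gamma (a + 1) *
        ∫ t in Set.Ioi (0 : ℝ), Real.cosh t ^ (-(a + 1)) * Real.cosh (ν * t) := by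
  have ha : -1 < a := by linarith [abs_nonneg ν]
  have h1 := integral_integral_swap
    (f := fun y t : ℝ => y ^ a * (Real.exp (-y * Real.cosh t) * Real.cosh (ν * t)))
    (integrable_besselK_kernel h)
  simp only [integral_rpow_mul_exp_neg_mul_cosh ν _ ha, integral_const_mul] at h1
  exact h1

lemma integral_rpow_mul_besselK_add_two {ν a : ℝ} (h : |ν| < a + 1) :
    ∫ y in Set.Ioi (0 : ℝ), y ^ (a + 2) * besselK ν y =
      ((a + 1) ^ 2 - ν ^ 2) * ∫ y in Set.Ioi (0 : ℝ), y ^ a * besselK ν y := by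
  have ha : 0 < a + 1 := (abs_nonneg ν).trans_lt h
  rw [integral_rpow_mul_besselK h, integral_rpow_mul_besselK (by linarith)]
  have h1 := integral_cosh_rpow_recurrence h
  rw [show a + 1 + 2 = a + 2 + 1 by ring] at h1
  rw [Real.Gamma_add_one (by linarith), show a + 2 = a + 1 + 1 by ring,
    Real.Gamma_add_one ha.ne', show a + 1 + 1 + 1 = a + 2 + 1 by ring]
  linear_combination Real.Gamma (a + 1) * h1

lemma weightW_eq {μ ν : ℝ} (heven : ∃ m : ℕ, μ - ν = 2 * m) (x : ℝ) :
    weightW μ ν x = 1 / 2 * x ^ ((μ - 1) / 2) * besselK ν (Real.sqrt x) := by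
  obtain ⟨m, hm⟩ := heven
  exact if_pos ⟨m, by exact_mod_cast hm⟩

lemma abs_lt_add_one {μ ν : ℝ} (h1 : -1 < μ + ν) (heven : ∃ m : ℕ, μ - ν = 2 * m) (k : ℕ) :
    |ν| < μ + 2 * k + 1 := by
  obtain ⟨m, hm⟩ := heven
  have := Nat.cast_nonneg (α := ℝ) m
  have := Nat.cast_nonneg (α := ℝ) k
  rw [abs_lt]
  constructor <;> linarith

lemma weightW_pos {μ ν : ℝ} (heven : ∃ m : ℕ, μ - ν = 2 * m) {x : ℝ} (hx : 0 < x) :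
    0 < weightW μ ν x := by
  rw [weightW_eq heven]
  have := besselK_pos ν (Real.sqrt_pos.2 hx)
  positivity

lemma weightW_substitution {μ ν : ℝ} (heven : ∃ m : ℕ, μ - ν = 2 * m) (k : ℕ) {y : ℝ}
    (hy : 0 < y) :
    (|(2 : ℝ)| * y ^ ((2 : ℝ) - 1)) • (weightW μ ν (y ^ (2 : ℝ)) * (y ^ (2 : ℝ)) ^ k) =
      y ^ (μ + 2 * k) * besselK ν y := by
  rw [weightW_eq heven, ← Real.rpow_mul hy.le, Real.rpow_two, Real.sqrt_sq hy.le,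
    Real.rpow_add hy, show (2 * k : ℝ) = ((2 * k : ℕ) : ℝ) by simp, Real.rpow_natCast,
    show μ = 2 * ((μ - 1) / 2) + 1 by ring, Real.rpow_add_one hy.ne',
    show (2 : ℝ) - 1 = 1 by norm_num, Real.rpow_one, abs_two, smul_eq_mul]
  ring_nf

lemma integrableOn_weightW_mul_pow {μ ν : ℝ} (h1 : -1 < μ + ν)
    (heven : ∃ m : ℕ, μ - ν = 2 * m) (k : ℕ) :
    IntegrableOn (fun x : ℝ => weightW μ ν x * x ^ k) (Set.Ioi 0) := by
  rw [← integrableOn_Ioi_comp_rpow_iff _ (two_ne_zero (α := ℝ))]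
  exact (integrableOn_rpow_mul_besselK (abs_lt_add_one h1 heven k)).congr_fun
    (fun y hy => (weightW_substitution heven k hy).symm) measurableSet_Ioi

/-- The moments of the weight `w_{μ,ν}`. -/
def weightMoment (μ ν : ℝ) (k : ℕ) : ℝ := ∫ x in Set.Ioi (0 : ℝ), weightW μ ν x * x ^ k

lemma weightMoment_eq {μ ν : ℝ} (heven : ∃ m : ℕ, μ - ν = 2 * m) (k : ℕ) :
    weightMoment μ ν k = ∫ y in Set.Ioi (0 : ℝ), y ^ (μ + 2 * k) * besselK ν y := by
  rw [weightMoment, ← integral_comp_rpow_Ioi _ (two_ne_zero (α := ℝ))]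
  exact setIntegral_congr_fun measurableSet_Ioi
    fun y hy => weightW_substitution heven k hy

lemma weightMoment_succ {μ ν : ℝ} (h1 : -1 < μ + ν) (heven : ∃ m : ℕ, μ - ν = 2 * m) (k : ℕ) :
    weightMoment μ ν (k + 1) = ((μ + 2 * k + 1) ^ 2 - ν ^ 2) * weightMoment μ ν k := by
  rw [weightMoment_eq heven, weightMoment_eq heven,
    ← integral_rpow_mul_besselK_add_two (abs_lt_add_one h1 heven k)]
  push_cast
  ring_nf

lemma HasAbelLimit.add {f g : ℝ → ℂ} {a b : ℂ} (hf : HasAbelLimit f a) (hg : HasAbelLimit g b) :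
    HasAbelLimit (fun x => f x + g x) (a + b) := by
  refine ⟨fun s hs => ?_, ?_⟩
  · simp only [mul_add]
    exact (hf.1 s hs).add (hg.1 s hs)
  · refine (hf.2.add hg.2).congr' ?_
    filter_upwards [self_mem_nhdsWithin] with s hs
    simp only [mul_add]
    exact (integral_add (hf.1 s hs) (hg.1 s hs)).symm

lemma HasAbelLimit.const_mul {f : ℝ → ℂ} {a : ℂ} (c : ℂ) (hf : HasAbelLimit f a) :
    HasAbelLimit (fun x => c * f x) (c * a) := by
  refine ⟨fun s hs => ?_, ?_⟩
  · simp only [mul_left_comm _ c]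
    exact (hf.1 s hs).const_mul c
  · simp only [mul_left_comm _ c, integral_const_mul]
    exact hf.2.const_mul c

lemma HasAbelLimit.congr {f g : ℝ → ℂ} {a : ℂ} (hf : HasAbelLimit f a)
    (h : ∀ x : ℝ, 0 < x → f x = g x) : HasAbelLimit g a := by
  refine ⟨fun s hs => ?_, ?_⟩
  · refine (hf.1 s hs).congr_fun (fun x hx => ?_) measurableSet_Ioi
    simp only [h x hx]
  · refine hf.2.congr fun s => setIntegral_congr_fun measurableSet_Ioi fun x hx => ?_
    simp only [h x hx]

lemma HasAbelLimit.unique {f : ℝ → ℂ} {a b : ℂ} (ha : HasAbelLimit f a)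
    (hb : HasAbelLimit f b) : a = b :=
  tendsto_nhds_unique ha.2 hb.2

/-- The Abel limit of `∫₀^∞ x^{μ+i} J_ν(x) dx` when `μ = ν + 2m`. -/
def abelMoment (ν : ℝ) (m i : ℕ) : ℝ := ((2 : ℝ) ^ ν)⁻¹ * besselMoment (2 * m + i) ν

lemma hasAbelLimit_rpow_mul_besselJ {μ ν : ℝ} (h1 : -1 < μ + ν) {m : ℕ} (hm : μ - ν = 2 * m)
    (i : ℕ) :
    HasAbelLimit (fun x : ℝ => ((x ^ ((i : ℝ) + μ) : ℝ) : ℂ) * (besselJ ν x : ℂ))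
      (abelMoment ν m i) := by
  have hp : 0 < 2 * ν + 1 + (2 * m + i : ℕ) := by
    push_cast
    have := Nat.cast_nonneg (α := ℝ) i
    linarith
  have hpt : ∀ s : ℝ, ∀ x ∈ Set.Ioi (0 : ℝ),
      (((((2 : ℝ) ^ ν)⁻¹ * (Real.exp (-(s * x)) * x ^ (2 * ν + 1 + (2 * m + i : ℕ) - 1) *
        besselCore ν x) : ℝ)) : ℂ) = Complex.exp (-(s : ℂ) * (x : ℂ)) *
          (((x ^ ((i : ℝ) + μ) : ℝ) : ℂ) * (besselJ ν x : ℂ)) := by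
    intro s x hx
    have hx' : 0 < x := hx
    have e : Complex.exp (-(s : ℂ) * (x : ℂ)) = ((Real.exp (-(s * x)) : ℝ) : ℂ) := by
      push_cast
      ring_nf
    rw [e, ← Complex.ofReal_mul, ← Complex.ofReal_mul]
    congr 1
    rw [besselJ_eq_mul_besselCore ν hx', Real.div_rpow hx'.le (by norm_num),
      show 2 * ν + 1 + (2 * m + i : ℕ) - 1 = (i + μ) + ν by push_cast; linarith,
      Real.rpow_add hx']
    ring
  refine ⟨fun s hs => ?_, ?_⟩
  · refine IntegrableOn.congr_fun ?_ (hpt s) measurableSet_Ioi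
    exact ((integrableOn_besselLaplace ν hp hs).const_mul _).ofReal
  · have h2 := ((tendsto_besselLaplace (2 * m + i) ν hp).const_mul ((2 : ℝ) ^ ν)⁻¹)
    refine ((Complex.continuous_ofReal.tendsto _).comp h2).congr fun s => ?_
    rw [← setIntegral_congr_fun measurableSet_Ioi (hpt s), Function.comp_apply, besselLaplace,
      ← integral_const_mul]
    exact integral_ofReal.symm

/-- The linear functional on `ℂ[X]` with moments `M`. -/
def momentFunctional (M : ℕ → ℝ) : ℂ[X] →ₗ[ℂ] ℂ :=
  Polynomial.lsum fun i => LinearMap.mulRight ℂ (M i : ℂ)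

lemma momentFunctional_monomial (M : ℕ → ℝ) (i : ℕ) (a : ℂ) :
    momentFunctional M (monomial i a) = a * M i := by
  simp [momentFunctional, Polynomial.lsum_apply, Polynomial.sum_monomial_index]

lemma momentFunctional_C_mul (M : ℕ → ℝ) (a : ℂ) (p : ℂ[X]) :
    momentFunctional M (C a * p) = a * momentFunctional M p := by
  rw [← smul_eq_C_mul, map_smul, smul_eq_mul]

lemma hasAbelLimit_polynomial {μ ν : ℝ} (h1 : -1 < μ + ν) {m : ℕ} (hm : μ - ν = 2 * m)
    (P : ℂ[X]) (k : ℕ) :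
    HasAbelLimit
      (fun x : ℝ => P.eval (x : ℂ) * ((x ^ ((k : ℝ) + μ) : ℝ) : ℂ) * (besselJ ν x : ℂ))
      (momentFunctional (abelMoment ν m) (P * X ^ k)) := by
  induction P using Polynomial.induction_on' with
  | add p q hp hq =>
    rw [add_mul, map_add]
    refine (hp.add hq).congr fun x _ => ?_
    rw [eval_add]; ring
  | monomial i a =>
    rw [monomial_mul_X_pow, momentFunctional_monomial]
    refine ((hasAbelLimit_rpow_mul_besselJ h1 hm (i + k)).const_mul a).congr fun x hx => ?_
    rw [eval_monomial, Nat.cast_add, add_assoc, Real.rpow_add hx, Real.rpow_natCast]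
    push_cast
    ring

lemma abelMoment_odd (ν : ℝ) (m i : ℕ) : abelMoment ν m (2 * i + 1) = 0 := by
  rw [abelMoment, ← add_assoc, ← mul_add, besselMoment_odd, mul_zero]

lemma weightMoment_zero_pos {μ ν : ℝ} (h1 : -1 < μ + ν) (heven : ∃ m : ℕ, μ - ν = 2 * m) :
    0 < weightMoment μ ν 0 := by
  rw [weightMoment, setIntegral_pos_iff_support_of_nonneg_ae _
    (integrableOn_weightW_mul_pow h1 heven 0)]
  · have : (Function.support fun x : ℝ => weightW μ ν x * x ^ 0) ∩ Set.Ioi 0 = Set.Ioi 0 := by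
      refine Set.inter_eq_right.2 fun x hx => ?_
      simpa using (weightW_pos heven hx).ne'
    rw [this]
    simp
  · refine (ae_restrict_iff' measurableSet_Ioi).2 (ae_of_all _ fun x hx => ?_)
    simpa using (weightW_pos heven hx).le

/-- The even Abel moments of `x^μ J_ν` are proportional to the alternating moments of
`w_{μ,ν}`. -/
lemma exists_abelMoment_even_eq {μ ν : ℝ} (h1 : -1 < μ + ν) {m : ℕ} (hm : μ - ν = 2 * m) :
    ∃ c : ℝ, c ≠ 0 ∧ ∀ k : ℕ, abelMoment ν m (2 * k) = c * (-1) ^ k * weightMoment μ ν k := by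
  have hW := (weightMoment_zero_pos h1 ⟨m, hm⟩).ne'
  have hpos : ∀ k : ℕ, 0 < 2 * ν + 1 + 2 * ((m + k : ℕ) : ℝ) := by
    intro k
    have := Nat.cast_nonneg (α := ℝ) k
    push_cast
    linarith
  refine ⟨abelMoment ν m 0 / weightMoment μ ν 0, div_ne_zero ?_ hW, fun k => ?_⟩
  · refine mul_ne_zero (inv_ne_zero (Real.rpow_pos_of_pos two_pos ν).ne') ?_
    exact besselMoment_even_ne_zero m ν (hpos 0)
  · induction k with
    | zero => simp [div_mul_cancel₀ _ hW]
    | succ k ih =>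
      have h2 := besselMoment_even_succ (m + k) ν (hpos k)
      have h3 : abelMoment ν m (2 * (k + 1)) =
          -((2 * (m + k : ℕ) + 1) * (2 * ν + 2 * (m + k : ℕ) + 1)) * abelMoment ν m (2 * k) := by
        rw [abelMoment, abelMoment, ← mul_add, ← mul_add, ← add_assoc, h2]
        ring_nf
      rw [h3, ih, weightMoment_succ h1 ⟨m, hm⟩, show μ = ν + 2 * m by linarith]
      push_cast
      ring

lemma integrableOn_weightW_mul_polynomial {μ ν : ℝ} (h1 : -1 < μ + ν)
    (heven : ∃ m : ℕ, μ - ν = 2 * m) (φ : ℝ[X]) (j : ℕ) :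
    IntegrableOn (fun x : ℝ => weightW μ ν x * φ.eval x * x ^ j) (Set.Ioi 0) := by
  induction φ using Polynomial.induction_on' with
  | add p q hp hq =>
    simp only [eval_add, mul_add, add_mul]
    exact hp.add hq
  | monomial i a =>
    refine ((integrableOn_weightW_mul_pow h1 heven (i + j)).const_mul a).congr
      (ae_of_all _ fun x => ?_)
    simp only [eval_monomial]
    ring

lemma momentFunctional_comp_neg_sq {μ ν c : ℝ} (h1 : -1 < μ + ν)
    (heven : ∃ m : ℕ, μ - ν = 2 * m) {M : ℕ → ℝ}
    (hM : ∀ k : ℕ, M (2 * k) = c * (-1) ^ k * weightMoment μ ν k) (φ : ℝ[X]) (j : ℕ) :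
    momentFunctional M ((φ.map (algebraMap ℝ ℂ)).comp (-(X ^ 2)) * X ^ (2 * j)) =
      ((c * (-1) ^ j * ∫ x in Set.Ioi (0 : ℝ), weightW μ ν x * φ.eval x * x ^ j : ℝ) : ℂ) := by
  induction φ using Polynomial.induction_on' with
  | add p q hp hq =>
    have hpi := integrableOn_weightW_mul_polynomial h1 heven p j
    have hqi := integrableOn_weightW_mul_polynomial h1 heven q j
    simp only [eval_add, mul_add, add_mul]
    rw [integral_add hpi hqi, Polynomial.map_add, add_comp, add_mul, map_add, hp, hq]
    push_cast
    ring
  | monomial i a =>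
    have e1 : (((monomial i a : ℝ[X]).map (algebraMap ℝ ℂ)).comp (-(X ^ 2)) * X ^ (2 * j) : ℂ[X])
        = monomial (2 * (i + j)) ((a : ℂ) * (-1) ^ i) := by
      rw [map_monomial, monomial_comp, neg_pow, ← C_mul_X_pow_eq_monomial, C_mul, C_pow, C_neg,
        C_1, mul_add 2, pow_add, pow_mul X 2 i]
      simp only [Complex.coe_algebraMap]
      ring
    have e2 : ∫ x in Set.Ioi (0 : ℝ), weightW μ ν x * (monomial i a : ℝ[X]).eval x * x ^ j =
        a * weightMoment μ ν (i + j) := by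
      rw [weightMoment, ← integral_const_mul]
      refine setIntegral_congr_fun measurableSet_Ioi fun x _ => ?_
      simp only [eval_monomial]
      ring
    rw [e1, e2, momentFunctional_monomial, hM, pow_add]
    push_cast
    have : ((-1 : ℂ) ^ i) * (-1) ^ i = 1 := by rw [← mul_pow]; simp
    linear_combination (a * c * (-1) ^ j * (weightMoment μ ν (i + j) : ℂ)) * this

lemma momentFunctional_comp_neg_X {M : ℕ → ℝ} (hM : ∀ k : ℕ, M (2 * k + 1) = 0) (p : ℂ[X]) :
    momentFunctional M (p.comp (-X)) = momentFunctional M p := by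
  induction p using Polynomial.induction_on' with
  | add p q hp hq => rw [add_comp, map_add, map_add, hp, hq]
  | monomial i a =>
    rw [monomial_comp, neg_pow, ← mul_assoc, ← C_1, ← C_neg, ← C_pow, ← C_mul,
      C_mul_X_pow_eq_monomial, momentFunctional_monomial, momentFunctional_monomial]
    rcases Nat.even_or_odd' i with ⟨k, rfl | rfl⟩
    · simp
    · simp [hM]

lemma momentFunctional_mul_X_pow (M : ℕ → ℝ) {p : ℂ[X]} {N : ℕ} (hp : p.natDegree < N) (k : ℕ) :
    momentFunctional M (p * X ^ k) = ∑ i ∈ Finset.range N, p.coeff i * M (i + k) := by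
  conv_lhs => rw [p.as_sum_range' N hp]
  rw [Finset.sum_mul, map_sum]
  refine Finset.sum_congr rfl fun i _ => ?_
  rw [monomial_mul_X_pow, momentFunctional_monomial]

/-- The Hankel form of a positive weight is nondegenerate. -/
lemma hankel_nondegenerate_real {g : ℝ → ℝ} (hg : ∀ x, 0 < x → 0 < g x)
    (hint : ∀ k : ℕ, IntegrableOn (fun x : ℝ => g x * x ^ k) (Set.Ioi 0)) {n : ℕ} (e : ℕ → ℝ)
    (he : ∀ j < n, ∑ i ∈ Finset.range n, e i * ∫ x in Set.Ioi (0 : ℝ), g x * x ^ (i + j) = 0) :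
    ∀ i < n, e i = 0 := by
  set q : ℝ[X] := ∑ i ∈ Finset.range n, monomial i (e i)
  have hq : ∀ x : ℝ, q.eval x = ∑ i ∈ Finset.range n, e i * x ^ i := fun x => by
    simp [q, eval_finsetSum, eval_monomial]
  have hexp : ∀ x : ℝ, g x * q.eval x ^ 2 = ∑ j ∈ Finset.range n, ∑ i ∈ Finset.range n,
      e j * e i * (g x * x ^ (i + j)) := by
    intro x
    rw [hq, sq, Finset.sum_mul_sum, Finset.mul_sum]
    refine Finset.sum_congr rfl fun j _ => ?_
    rw [Finset.mul_sum]
    refine Finset.sum_congr rfl fun i _ => ?_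
    ring
  have hqi : IntegrableOn (fun x : ℝ => g x * q.eval x ^ 2) (Set.Ioi 0) := by
    simp only [hexp]
    exact integrable_finsetSum _ fun j _ => integrable_finsetSum _ fun i _ =>
      (hint (i + j)).const_mul _
  have hzero : ∫ x in Set.Ioi (0 : ℝ), g x * q.eval x ^ 2 = 0 := by
    simp only [hexp]
    rw [integral_finsetSum _ fun j _ => integrable_finsetSum _ fun i _ =>
      (hint (i + j)).const_mul _]
    refine Finset.sum_eq_zero fun j hj => ?_
    rw [integral_finsetSum _ fun i _ => (hint (i + j)).const_mul _]
    simp only [integral_const_mul, mul_assoc]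
    rw [← Finset.mul_sum, he j (Finset.mem_range.1 hj), mul_zero]
  rw [setIntegral_eq_zero_iff_of_nonneg_ae ((ae_restrict_iff' measurableSet_Ioi).2
    (ae_of_all _ fun x hx => mul_nonneg (hg x hx).le (sq_nonneg _))) hqi,
    EventuallyEq, ae_restrict_iff' measurableSet_Ioi] at hzero
  have hroot : q = 0 := by
    refine Polynomial.eq_zero_of_infinite_isRoot _ fun hfin => ?_
    have hnot : ∀ᵐ x : ℝ, x ∉ {x | q.IsRoot x} :=
      measure_eq_zero_iff_ae_notMem.1 (hfin.measure_zero volume)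
    have hall : ∀ᵐ x : ℝ, x ∉ Set.Ioi (0 : ℝ) := by
      filter_upwards [hzero, hnot] with x h1 h2 hx
      have := h1 hx
      simp only [Pi.zero_apply, mul_eq_zero, (hg x hx).ne', false_or] at this
      exact h2 (pow_eq_zero_iff two_ne_zero |>.1 this)
    have := measure_eq_zero_iff_ae_notMem.2 hall
    simp at this
  intro i hi
  have hcoeff : q.coeff i = e i := by
    simp [q, coeff_monomial, hi.not_ge]
  rw [← hcoeff, hroot, coeff_zero]

lemma hankel_nondegenerate {g : ℝ → ℝ} (hg : ∀ x, 0 < x → 0 < g x)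
    (hint : ∀ k : ℕ, IntegrableOn (fun x : ℝ => g x * x ^ k) (Set.Ioi 0)) {n : ℕ} (e : ℕ → ℂ)
    (he : ∀ j < n, ∑ i ∈ Finset.range n,
      e i * ((∫ x in Set.Ioi (0 : ℝ), g x * x ^ (i + j) : ℝ) : ℂ) = 0) :
    ∀ i < n, e i = 0 := by
  intro i hi
  refine Complex.ext ?_ ?_
  · refine hankel_nondegenerate_real hg hint (fun i => (e i).re) (fun j hj => ?_) i hi
    simpa using congrArg Complex.re (he j hj)
  · refine hankel_nondegenerate_real hg hint (fun i => (e i).im) (fun j hj => ?_) i hi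
    simpa using congrArg Complex.im (he j hj)

lemma sum_range_two_mul {A : Type*} [AddCommMonoid A] (f : ℕ → A) (n : ℕ) :
    ∑ i ∈ Finset.range (2 * n), f i =
      ∑ i ∈ Finset.range n, f (2 * i) + ∑ i ∈ Finset.range n, f (2 * i + 1) := by
  induction n with
  | zero => simp
  | succ n ih =>
    rw [show 2 * (n + 1) = 2 * n + 1 + 1 by ring, Finset.sum_range_succ, Finset.sum_range_succ, ih,
      Finset.sum_range_succ, Finset.sum_range_succ]
    abel

/-- The functional whose odd moments vanish and whose even moments are the alternating moments
of `w_{μ,ν}` is nondegenerate on polynomials of degree at most `2n`. -/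
lemma eq_zero_of_momentFunctional_eq_zero {μ ν c : ℝ} (h1 : -1 < μ + ν)
    (heven : ∃ m : ℕ, μ - ν = 2 * m) (hc : c ≠ 0) {M : ℕ → ℝ}
    (hodd : ∀ k : ℕ, M (2 * k + 1) = 0)
    (hM : ∀ k : ℕ, M (2 * k) = c * (-1) ^ k * weightMoment μ ν k) {n : ℕ} {D : ℂ[X]}
    (hdeg : D.natDegree < 2 * n + 1)
    (hD : ∀ k < 2 * n + 1, momentFunctional M (D * X ^ k) = 0) : D = 0 := by
  have hg : ∀ x : ℝ, 0 < x → 0 < weightW μ ν x := fun x hx => weightW_pos heven hx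
  have hsum : ∀ k < 2 * n + 1,
      ∑ i ∈ Finset.range (n + 1), D.coeff (2 * i) * (M (2 * i + k) : ℂ) +
      ∑ i ∈ Finset.range (n + 1), D.coeff (2 * i + 1) * (M (2 * i + 1 + k) : ℂ) = 0 := by
    intro k hk
    rw [← sum_range_two_mul (fun i => D.coeff i * (M (i + k) : ℂ)), ← hD k hk,
      momentFunctional_mul_X_pow M (N := 2 * (n + 1)) (by omega) k]
  have hc' : (c : ℂ) ≠ 0 := by exact_mod_cast hc
  have hev : ∀ i < n + 1, (-1 : ℂ) ^ i * D.coeff (2 * i) = 0 := by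
    refine hankel_nondegenerate hg (integrableOn_weightW_mul_pow h1 heven) _ fun j hj => ?_
    have h := hsum (2 * j) (by omega)
    rw [Finset.sum_eq_zero (s := Finset.range (n + 1))
      (f := fun i => D.coeff (2 * i + 1) * (M (2 * i + 1 + 2 * j) : ℂ)), add_zero] at h
    · have h' : (c : ℂ) * (-1) ^ j * ∑ i ∈ Finset.range (n + 1), (-1 : ℂ) ^ i * D.coeff (2 * i) *
          ((∫ x in Set.Ioi (0 : ℝ), weightW μ ν x * x ^ (i + j) : ℝ) : ℂ) = 0 := by
        rw [← h, Finset.mul_sum]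
        refine Finset.sum_congr rfl fun i _ => ?_
        rw [← mul_add, hM, weightMoment]
        push_cast
        ring
      exact (mul_eq_zero.1 h').resolve_left (mul_ne_zero hc' (by simp))
    · intro i _
      rw [show 2 * i + 1 + 2 * j = 2 * (i + j) + 1 by ring, hodd]
      simp
  have hod : ∀ i < n, (-1 : ℂ) ^ i * D.coeff (2 * i + 1) = 0 := by
    refine hankel_nondegenerate (g := fun x => weightW μ ν x * x)
      (fun x hx => mul_pos (hg x hx) hx) (fun k => ?_) _ fun j hj => ?_
    · simp only [mul_assoc, ← pow_succ']
      exact integrableOn_weightW_mul_pow h1 heven (k + 1)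
    have h := hsum (2 * j + 1) (by omega)
    rw [Finset.sum_eq_zero (s := Finset.range (n + 1))
      (f := fun i => D.coeff (2 * i) * (M (2 * i + (2 * j + 1)) : ℂ)), zero_add,
      Finset.sum_range_succ, coeff_eq_zero_of_natDegree_lt hdeg, zero_mul, add_zero] at h
    · have h' : (c : ℂ) * (-1) ^ (j + 1) * ∑ i ∈ Finset.range n,
          (-1 : ℂ) ^ i * D.coeff (2 * i + 1) *
          ((∫ x in Set.Ioi (0 : ℝ), weightW μ ν x * x * x ^ (i + j) : ℝ) : ℂ) = 0 := by
        rw [← h, Finset.mul_sum]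
        refine Finset.sum_congr rfl fun i _ => ?_
        simp only [mul_assoc, ← pow_succ']
        rw [show 2 * i + 1 + (2 * j + 1) = 2 * (i + j + 1) by ring, hM, weightMoment]
        push_cast
        ring
      exact (mul_eq_zero.1 h').resolve_left (mul_ne_zero hc' (by simp))
    · intro i _
      rw [show 2 * i + (2 * j + 1) = 2 * (i + j) + 1 by ring, hodd]
      simp
  ext i
  rw [coeff_zero]
  rcases le_or_gt (2 * n + 1) i with hi | hi
  · exact coeff_eq_zero_of_natDegree_lt (by omega)
  · rcases Nat.even_or_odd' i with ⟨k, rfl | rfl⟩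
    · simpa using hev k (by omega)
    · simpa using hod k (by omega)

/-- odd-degree orthogonal polynomials for `x^μ J_ν(x)`, `μ - ν` even.
The polynomial `P` is the rational expression
`(−1)^{n+1}(φ_{n+1}(−x²) − (φ_{n+1}(0)/φ_n(0)) φ_n(−x²))/x`, encoded by `X * P = num`. -/
theorem ortho_odd_degree_even_case (μ ν : ℝ) (h1 : -1 < μ + ν)
    (heven : ∃ m : ℕ, μ - ν = 2 * m) (n : ℕ) (φn φn1 : Polynomial ℝ)
    (hφn : IsMonicOrthoW μ ν n φn) (hφn1 : IsMonicOrthoW μ ν (n + 1) φn1)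
    (h0 : φn.eval 0 ≠ 0) :
    ∃ P : Polynomial ℂ,
      Polynomial.X * P =
        Polynomial.C ((-1 : ℂ) ^ (n + 1)) *
          ((φn1.map (algebraMap ℝ ℂ)).comp (-(Polynomial.X ^ 2)) -
            Polynomial.C ((φn1.eval 0 / φn.eval 0 : ℝ) : ℂ) *
              ((φn.map (algebraMap ℝ ℂ)).comp (-(Polynomial.X ^ 2)))) ∧
      MonicOrthoBessel μ ν (2 * n + 1) P ∧
      ∀ Q : Polynomial ℂ, MonicOrthoBessel μ ν (2 * n + 1) Q → Q = P := by
  obtain ⟨m, hm⟩ := heven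
  obtain ⟨hmonic, hdegn, horth⟩ := hφn
  obtain ⟨hmonic1, hdegn1, horth1⟩ := hφn1
  obtain ⟨c, hc, hM⟩ := exists_abelMoment_even_eq h1 hm
  have hodd := abelMoment_odd ν m
  set L := momentFunctional (abelMoment ν m)
  set r : ℝ := φn1.eval 0 / φn.eval 0
  set A : ℂ[X] := (φn1.map (algebraMap ℝ ℂ)).comp (-(X ^ 2))
  set B : ℂ[X] := (φn.map (algebraMap ℝ ℂ)).comp (-(X ^ 2))
  set num : ℂ[X] := C ((-1 : ℂ) ^ (n + 1)) * (A - C (r : ℂ) * B)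
  have heval : ∀ φ : ℝ[X], eval 0 (φ.map (algebraMap ℝ ℂ)) = ((φ.eval 0 : ℝ) : ℂ) := fun φ => by
    rw [← map_zero (algebraMap ℝ ℂ), eval_map_apply]; rfl
  have hdvd : X ∣ num := by
    rw [X_dvd_iff, coeff_zero_eq_eval_zero]
    simp only [num, A, B, eval_mul, eval_sub, eval_comp, eval_neg, eval_pow, eval_X, eval_C, ne_eq,
      OfNat.ofNat_ne_zero, not_false_eq_true, zero_pow, neg_zero, heval]
    rw [← Complex.ofReal_mul, div_mul_cancel₀ _ h0, sub_self, mul_zero]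
  have hq : natDegree (-(X ^ 2) : ℂ[X]) = 2 := by rw [natDegree_neg, natDegree_X_pow]
  have hA : A.natDegree = 2 * n + 2 := by
    rw [natDegree_comp, natDegree_map, hdegn1, hq]; ring
  have hB : B.natDegree = 2 * n := by
    rw [natDegree_comp, natDegree_map, hdegn, hq]; ring
  have hAm : (C ((-1 : ℂ) ^ (n + 1)) * A).Monic := by
    rw [Monic, leadingCoeff_mul, leadingCoeff_C, leadingCoeff_comp (by rw [hq]; norm_num),
      (hmonic1.map _).leadingCoeff, natDegree_map, hdegn1, leadingCoeff_neg,
      leadingCoeff_X_pow, one_mul, ← mul_pow]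
    simp
  have hAd : (C ((-1 : ℂ) ^ (n + 1)) * A).natDegree = 2 * n + 2 := by
    rw [natDegree_C_mul (by simp), hA]
  have hlt : natDegree (C ((-1 : ℂ) ^ (n + 1)) * (C (r : ℂ) * B)) <
      natDegree (C ((-1 : ℂ) ^ (n + 1)) * A) := by
    rw [hAd]
    have h2 := (natDegree_C_mul_le ((-1 : ℂ) ^ (n + 1)) (C (r : ℂ) * B)).trans
      (natDegree_C_mul_le (r : ℂ) B)
    omega
  have hnum : num = C ((-1 : ℂ) ^ (n + 1)) * A - C ((-1 : ℂ) ^ (n + 1)) * (C (r : ℂ) * B) :=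
    mul_sub _ _ _
  have hnm : num.Monic := by rw [hnum]; exact hAm.sub_of_left (degree_lt_degree hlt)
  have hnd : num.natDegree = 2 * n + 2 := by
    rw [hnum, natDegree_sub_eq_left_of_natDegree_lt hlt, hAd]
  obtain ⟨P, hP⟩ := hdvd
  have hPm : P.Monic := Monic.of_mul_monic_left monic_X (hP ▸ hnm)
  have hPd : P.natDegree = 2 * n + 1 := by
    have := natDegree_X_mul hPm.ne_zero
    rw [← hP, hnd] at this
    omega
  have hPneg : P.comp (-X) = -P := by
    have h2 : num.comp (-X) = num := by
      simp only [num, A, B, mul_comp, sub_comp, C_comp, comp_assoc, neg_comp, pow_comp, X_comp,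
        neg_sq]
    rw [hP, mul_comp, X_comp] at h2
    have h3 : X * P.comp (-X) = X * -P := by linear_combination -h2
    exact mul_left_cancel₀ X_ne_zero h3
  have hPL : ∀ k < 2 * n + 1, L (P * X ^ k) = 0 := by
    intro k hk
    rcases Nat.even_or_odd' k with ⟨j, rfl | rfl⟩
    · have h2 := momentFunctional_comp_neg_X hodd (P * X ^ (2 * j))
      rw [mul_comp, hPneg, pow_comp, X_comp, (even_two_mul j).neg_pow, neg_mul, map_neg] at h2
      exact self_eq_neg.1 h2.symm
    · have e : P * X ^ (2 * j + 1) = C ((-1 : ℂ) ^ (n + 1)) * (A * X ^ (2 * j)) -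
          C ((-1 : ℂ) ^ (n + 1)) * (C (r : ℂ) * (B * X ^ (2 * j))) := by
        linear_combination (-(X ^ (2 * j) : ℂ[X])) * hP + (X ^ (2 * j) : ℂ[X]) * hnum
      rw [e, map_sub, momentFunctional_C_mul, momentFunctional_C_mul, momentFunctional_C_mul,
        momentFunctional_comp_neg_sq h1 ⟨m, hm⟩ hM, momentFunctional_comp_neg_sq h1 ⟨m, hm⟩ hM,
        horth j (by omega), horth1 j (by omega)]
      simp
  refine ⟨P, hP.symm, ⟨hPm, hPd, fun k hk => ?_⟩, fun Q hQ => ?_⟩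
  · rw [← hPL k hk]
    exact hasAbelLimit_polynomial h1 hm P k
  · obtain ⟨hQm, hQd, hQo⟩ := hQ
    have hQL : ∀ k < 2 * n + 1, L (Q * X ^ k) = 0 := fun k hk =>
      (hasAbelLimit_polynomial h1 hm Q k).unique (hQo k hk)
    refine sub_eq_zero.1 (eq_zero_of_momentFunctional_eq_zero h1 ⟨m, hm⟩ hc hodd hM (n := n) ?_
      fun k hk => ?_)
    · rcases eq_or_ne (Q - P) 0 with h2 | h2
      · rw [h2, natDegree_zero]; omega
      · rw [← hQd]
        refine natDegree_lt_natDegree h2 (degree_sub_lt_left ?_ hQm.ne_zero ?_)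
        · rw [degree_eq_natDegree hQm.ne_zero, degree_eq_natDegree hPm.ne_zero, hQd, hPd]
        · rw [hQm.leadingCoeff, hPm.leadingCoeff]
    · rw [sub_mul, map_sub, hQL k hk, hPL k hk, sub_zero]

end
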